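/- arXiv:1703.08291 — 2 statements merged into one kernel-verified Lean document; each statement's English description precedes it below -/
import Mathlib

section
/- Sunflower construction: let S1, ..., Sq be q distinct subspaces of F_q^v, each of dimension at least r+1, all containing a common r-dimensional subspace T and pairwise intersecting exactly in T. Then the point set S = (S1 ∪ ... ∪ Sq) \ T (points covered by some S_i but not in T) is q^r-divisible: for every hyperplane H, the number of points of S outside H is divisible by q^r. -/
/-- Either no vector of `U` has value `1` under the functional `f`, or exactly a fraction
`1 / |F|` of the vectors of `U` do. -/
theorem Submodule.ncard_eq_one_eq_zero_or_card_mul {F V : Type*} [Field F] [Fintype F]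
    [AddCommGroup V] [Module F V] [Module.Finite F V] (f : V →ₗ[F] F) (U : Submodule F V) :
    {x | x ∈ U ∧ f x = 1}.ncard = 0 ∨
      Fintype.card F * {x | x ∈ U ∧ f x = 1}.ncard = Fintype.card F ^ Module.finrank F U := by
  rcases Set.eq_empty_or_nonempty {x | x ∈ U ∧ f x = 1} with h | ⟨x₀, hx₀, hf⟩
  · left
    rw [h, Set.ncard_empty]
  · right
    let e : U ≃ F × {x | x ∈ U ∧ f x = 1} :=
      { toFun := fun x => (f x - 1, ⟨x - (f x - 1) • x₀,
          U.sub_mem x.2 (U.smul_mem _ hx₀), by simp [hf]⟩)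
        invFun := fun p => ⟨p.2 + p.1 • x₀, U.add_mem p.2.2.1 (U.smul_mem _ hx₀)⟩
        left_inv := fun x => by simp
        right_inv := by
          rintro ⟨c, y, hy, hfy⟩
          simp [hf, hfy] }
    rw [← Nat.card_eq_fintype_card, ← Module.natCard_eq_pow_finrank (K := F) (V := U),
      Nat.card_congr e, Nat.card_prod, Nat.card_coe_set_eq]

/-- The points of projective space outside the hyperplane `ker f` correspond to the vectors
with value `1` under `f`. -/
theorem Submodule.ncard_points_not_le_ker {F V : Type*} [Field F]
    [AddCommGroup V] [Module F V] (f : V →ₗ[F] F) (p : Submodule F V → Prop) :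
    {P : Submodule F V | Module.finrank F P = 1 ∧ p P ∧ ¬ P ≤ LinearMap.ker f}.ncard =
      {x | p (F ∙ x) ∧ f x = 1}.ncard := by
  have himage : {P : Submodule F V | Module.finrank F P = 1 ∧ p P ∧ ¬ P ≤ LinearMap.ker f} =
      (fun x => F ∙ x) '' {x | p (F ∙ x) ∧ f x = 1} := by
    ext P
    constructor
    · rintro ⟨hP, hp, hker⟩
      obtain ⟨y, hy, hfy⟩ := SetLike.not_le_iff_exists.mp hker
      rw [LinearMap.mem_ker] at hfy
      have hspan : F ∙ ((f y)⁻¹ • y) = P := by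
        have hne : (f y)⁻¹ • y ≠ 0 := by
          intro h
          have := congrArg f h
          simp [hfy] at this
        have : Module.Finite F P := Module.finite_of_finrank_eq_succ hP
        refine Submodule.eq_of_le_of_finrank_eq ?_ ?_
        · rw [Submodule.span_singleton_le_iff_mem]
          exact P.smul_mem _ hy
        · rw [finrank_span_singleton hne, hP]
      exact ⟨(f y)⁻¹ • y, ⟨by rwa [hspan], by simp [hfy]⟩, hspan⟩
    · rintro ⟨x, ⟨hp, hx⟩, rfl⟩
      have hne : x ≠ 0 := by
        rintro rfl
        simp at hx
      refine ⟨finrank_span_singleton hne, hp, ?_⟩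
      simp [Submodule.span_singleton_le_iff_mem, hx]
  rw [himage]
  refine Set.InjOn.ncard_image ?_
  rintro x ⟨-, hx⟩ y ⟨-, hy⟩ hxy
  have hmem : x ∈ F ∙ y := by
    rw [← show F ∙ x = F ∙ y from hxy]
    exact Submodule.mem_span_singleton_self x
  obtain ⟨c, rfl⟩ := Submodule.mem_span_singleton.mp hmem
  have : c = 1 := by simpa [hy] using hx
  rw [this, one_smul]


/-- Sunflower construction: if q distinct subspaces of dimension ≥ r+1 pass through
a common r-subspace T and pairwise intersect exactly in T, then the set of points
covered by some member but not in T is q^r-divisible. -/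
theorem sunflower_divisible {F : Type*} [Field F] [Fintype F] {v r : ℕ}
    (hr : 1 ≤ r)
    (T : Submodule F (Fin v → F)) (hT : Module.finrank F T = r)
    (S : Fin (Fintype.card F) → Submodule F (Fin v → F))
    (hSinj : Function.Injective S)
    (hSdim : ∀ i, r + 1 ≤ Module.finrank F (S i))
    (hST : ∀ i, T ≤ S i)
    (hSint : ∀ i j, i ≠ j → S i ⊓ S j = T) :
    ∀ H : Submodule F (Fin v → F), Module.finrank F H = v - 1 →
      Fintype.card F ^ r ∣
        {P : Submodule F (Fin v → F) |
          Module.finrank F P = 1 ∧ (∃ i, P ≤ S i) ∧ ¬ P ≤ T ∧ ¬ P ≤ H}.ncard := by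
  intro H hH
  let i₀ : Fin (Fintype.card F) := ⟨0, Fintype.card_pos⟩
  have hv : r + 1 ≤ v := by
    simpa using (hSdim i₀).trans (Submodule.finrank_le (S i₀))
  have hHtop : H < ⊤ := by
    refine lt_top_iff_ne_top.mpr ?_
    rintro rfl
    rw [finrank_top, Module.finrank_fin_fun] at hH
    omega
  obtain ⟨f, hf, hle⟩ := H.exists_le_ker_of_lt_top hHtop
  have hker : H = LinearMap.ker f := by
    refine Submodule.eq_of_le_of_finrank_le hle ?_
    have hlt : LinearMap.ker f < ⊤ :=
      lt_top_iff_ne_top.mpr fun h => hf (LinearMap.ker_eq_top.mp h)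
    have := Submodule.finrank_lt hlt.ne
    rw [Module.finrank_fin_fun] at this
    omega
  subst hker
  have hpoints := Submodule.ncard_points_not_le_ker f fun P => (∃ i, P ≤ S i) ∧ ¬ P ≤ T
  simp only [and_assoc, Submodule.span_singleton_le_iff_mem] at hpoints
  rw [hpoints]
  have hunion : {x | (∃ i, x ∈ S i) ∧ x ∉ T ∧ f x = 1} =
      ⋃ i, {x | x ∈ S i ∧ f x = 1} \ {x | x ∈ T ∧ f x = 1} := by
    ext x
    simp only [Set.mem_ofPred_eq, Set.mem_iUnion, Set.mem_sdiff]
    grind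
  have hdisj : Pairwise (Function.onFun Disjoint
      fun i => {x | x ∈ S i ∧ f x = 1} \ {x | x ∈ T ∧ f x = 1}) := by
    intro i j hij
    refine Set.disjoint_left.mpr ?_
    rintro x ⟨⟨hi, hx⟩, hT'⟩ ⟨⟨hj, -⟩, -⟩
    exact hT' ⟨hSint i j hij ▸ Submodule.mem_inf.mpr ⟨hi, hj⟩, hx⟩
  rw [hunion, Set.ncard_iUnion_of_finite (fun _ => Set.toFinite _) hdisj,
    finsum_eq_sum_of_fintype]
  have hS : ∀ i, Fintype.card F ^ r ∣ {x | x ∈ S i ∧ f x = 1}.ncard := by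
    intro i
    rcases (S i).ncard_eq_one_eq_zero_or_card_mul f with h | h
    · simp [h]
    · refine Nat.dvd_of_mul_dvd_mul_left (Fintype.card_pos (α := F)) ?_
      rw [h, ← pow_succ']
      exact pow_dvd_pow _ (hSdim i)
  have hTdvd : Fintype.card F ^ r ∣ Fintype.card F * {x | x ∈ T ∧ f x = 1}.ncard := by
    rcases T.ncard_eq_one_eq_zero_or_card_mul f with h | h
    · simp [h]
    · rw [h, hT]
  have hsum : ∑ i, ({x | x ∈ S i ∧ f x = 1} \ {x | x ∈ T ∧ f x = 1}).ncard +
      Fintype.card F * {x | x ∈ T ∧ f x = 1}.ncard =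
      ∑ i, {x | x ∈ S i ∧ f x = 1}.ncard := by
    have hconst : Fintype.card F * {x | x ∈ T ∧ f x = 1}.ncard =
        ∑ _i : Fin (Fintype.card F), {x | x ∈ T ∧ f x = 1}.ncard := by simp
    rw [hconst, ← Finset.sum_add_distrib]
    refine Finset.sum_congr rfl fun i _ => ?_
    exact Set.ncard_sdiff_add_ncard_of_subset fun x hx => ⟨hST i hx.1, hx.2⟩
  refine (Nat.dvd_add_left hTdvd).mp ?_
  rw [hsum]
  exact Finset.dvd_sum fun i _ => hS i
end

section
/- The set of lengths of projective 4-divisible (doubly-even projective) binary linear codes is exactly {7, 8} ∪ {n : n ≥ 14}; in particular, no projective doubly-even binary code exists of length n for n ≤ 6 or 9 ≤ n ≤ 13, and codes exist for n = 7, 8 and all n ≥ 14. -/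
open Matrix

namespace BinaryCode

/-- The rows of `G` generate a doubly-even binary code, and the columns of `G` are distinct and
nonzero. -/
def IsProjectiveDoublyEven {ι κ : Type*} [Fintype ι] [Fintype κ]
    (G : Matrix ι κ (ZMod 2)) : Prop :=
  (∀ j, (fun i => G i j) ≠ 0) ∧
    (∀ j1 j2 : κ, (fun i => G i j1) = (fun i => G i j2) → j1 = j2) ∧
    ∀ x : ι → ZMod 2, 4 ∣ hammingNorm (x ᵥ* G)

/-- `n` is the length of a projective doubly-even binary code. -/
def IsLength (n : ℕ) : Prop :=
  ∃ (k : ℕ) (G : Matrix (Fin k) (Fin n) (ZMod 2)), IsProjectiveDoublyEven G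

section Constructions

variable {ι κ ι' κ' : Type*} [Fintype ι] [Fintype κ] [Fintype ι'] [Fintype κ']

theorem hammingNorm_sumElim (u : κ → ZMod 2) (v : κ' → ZMod 2) :
    hammingNorm (Sum.elim u v) = hammingNorm u + hammingNorm v := by
  simp only [hammingNorm, Finset.card_filter, Fintype.sum_sum_type, Sum.elim_inl, Sum.elim_inr]
  rfl

theorem hammingNorm_comp_equiv (e : κ' ≃ κ) (u : κ → ZMod 2) :
    hammingNorm (u ∘ e) = hammingNorm u := by
  simp only [hammingNorm, Finset.card_filter, Function.comp_apply]
  exact e.sum_comp fun j => if u j ≠ 0 then 1 else 0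

theorem IsProjectiveDoublyEven.fromBlocks {A : Matrix ι κ (ZMod 2)} {D : Matrix ι' κ' (ZMod 2)}
    (hA : IsProjectiveDoublyEven A) (hD : IsProjectiveDoublyEven D) :
    IsProjectiveDoublyEven (Matrix.fromBlocks A 0 0 D) := by
  obtain ⟨hA0, hA1, hA4⟩ := hA
  obtain ⟨hD0, hD1, hD4⟩ := hD
  refine ⟨?_, ?_, fun x => ?_⟩
  · rintro (j | j) h
    · exact hA0 j (funext fun i => congrFun h (Sum.inl i))
    · exact hD0 j (funext fun i => congrFun h (Sum.inr i))
  · rintro (j | j) (l | l) h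
    · exact congrArg _ (hA1 j l (funext fun i => congrFun h (Sum.inl i)))
    · exact absurd (funext fun i => congrFun h (Sum.inl i)) (hA0 j)
    · exact absurd (funext fun i => congrFun h (Sum.inr i)) (hD0 j)
    · exact congrArg _ (hD1 j l (funext fun i => congrFun h (Sum.inr i)))
  · rw [vecMul_fromBlocks, hammingNorm_sumElim]
    simpa using dvd_add (hA4 (x ∘ Sum.inl)) (hD4 (x ∘ Sum.inr))

theorem IsProjectiveDoublyEven.submatrix {G : Matrix ι κ (ZMod 2)}
    (hG : IsProjectiveDoublyEven G) (e : ι' ≃ ι) (f : κ' ≃ κ) :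
    IsProjectiveDoublyEven (G.submatrix e f) := by
  obtain ⟨h0, h1, h4⟩ := hG
  refine ⟨fun j h => h0 (f j) ?_, fun j l h => f.injective (h1 _ _ ?_), fun x => ?_⟩
  · exact funext fun i => by simpa using congrFun h (e.symm i)
  · exact funext fun i => by simpa using congrFun h (e.symm i)
  · rw [submatrix_vecMul_equiv, hammingNorm_comp_equiv]
    exact h4 _

theorem IsLength.add {m n : ℕ} (hm : IsLength m) (hn : IsLength n) : IsLength (m + n) := by
  obtain ⟨k, A, hA⟩ := hm
  obtain ⟨l, D, hD⟩ := hn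
  exact ⟨k + l, _, (hA.fromBlocks hD).submatrix finSumFinEquiv.symm finSumFinEquiv.symm⟩

theorem hammingNorm_add (u v : κ → ZMod 2) :
    hammingNorm (u + v) + 2 * (Finset.univ.filter fun j => u j * v j ≠ 0).card =
      hammingNorm u + hammingNorm v := by
  simp only [hammingNorm, Finset.card_filter, Finset.mul_sum, ← Finset.sum_add_distrib]
  refine Finset.sum_congr rfl fun j _ => ?_
  have key : ∀ a b : ZMod 2, ((if a + b ≠ 0 then 1 else 0) + 2 * if a * b ≠ 0 then 1 else 0) =
      (if a ≠ 0 then 1 else 0) + if b ≠ 0 then 1 else 0 := by decide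
  exact key (u j) (v j)

theorem cast_card_mul_ne_zero (u v : κ → ZMod 2) :
    ((Finset.univ.filter fun j => u j * v j ≠ 0).card : ZMod 2) = u ⬝ᵥ v := by
  simp only [Finset.card_filter, Nat.cast_sum, dotProduct]
  refine Finset.sum_congr rfl fun j _ => ?_
  have key : ∀ a : ZMod 2, ((if a ≠ 0 then 1 else 0 : ℕ) : ZMod 2) = a := by decide
  exact key _

/-- Orthogonal vectors of doubly-even weight have a sum of doubly-even weight. -/
theorem four_dvd_hammingNorm_add {u v : κ → ZMod 2} (hu : 4 ∣ hammingNorm u)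
    (hv : 4 ∣ hammingNorm v) (huv : u ⬝ᵥ v = 0) : 4 ∣ hammingNorm (u + v) := by
  have h := hammingNorm_add u v
  rw [← cast_card_mul_ne_zero, ZMod.natCast_eq_zero_iff] at huv
  omega

/-- A self-orthogonal matrix with doubly-even rows generates a doubly-even code. -/
theorem four_dvd_hammingNorm_vecMul {G : Matrix ι κ (ZMod 2)} (h4 : ∀ i, 4 ∣ hammingNorm (G i))
    (horth : ∀ i i', G i ⬝ᵥ G i' = 0) (x : ι → ZMod 2) : 4 ∣ hammingNorm (x ᵥ* G) := by
  classical
  rw [vecMul_eq_sum]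
  have aux : ∀ s : Finset ι, 4 ∣ hammingNorm (∑ i ∈ s, x i • G i) := by
    intro s
    induction s using Finset.induction_on with
    | empty => simp
    | insert a s ha ih =>
      rw [Finset.sum_insert ha]
      refine four_dvd_hammingNorm_add ?_ ih ?_
      · have key : ∀ a : ZMod 2, a = 0 ∨ a = 1 := by decide
        rcases key (x a) with h | h <;> simp [h, h4]
      · simp [dotProduct_sum, horth]
  exact aux _

/-- The matrix with `k` rows whose columns are the binary expansions of the entries of `c`. -/
def ofColumns (k : ℕ) {n : ℕ} (c : Fin n → ℕ) : Matrix (Fin k) (Fin n) (ZMod 2) :=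
  fun i j => if (c j).testBit i then 1 else 0

theorem isLength_of_columns (k : ℕ) {n : ℕ} (c : Fin n → ℕ) (hpos : ∀ j, c j ≠ 0)
    (hlt : ∀ j, c j < 2 ^ k) (hinj : ∀ j l, c j = c l → j = l)
    (h4 : ∀ i, 4 ∣ hammingNorm (ofColumns k c i))
    (horth : ∀ i i', ofColumns k c i ⬝ᵥ ofColumns k c i' = 0) : IsLength n := by
  have bit : ∀ a b : Bool, (if a then 1 else 0 : ZMod 2) = (if b then 1 else 0) → a = b := by
    decide
  have ext_bits : ∀ a b : ℕ, a < 2 ^ k → b < 2 ^ k →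
      (∀ i : Fin k, (if a.testBit i then 1 else 0 : ZMod 2) = if b.testBit i then 1 else 0) →
      a = b := by
    intro a b ha hb h
    refine Nat.eq_of_testBit_eq fun i => ?_
    by_cases hi : i < k
    · exact bit _ _ (h ⟨i, hi⟩)
    · have hk : 2 ^ k ≤ 2 ^ i := Nat.pow_le_pow_right two_pos (not_lt.mp hi)
      rw [Nat.testBit_lt_two_pow (ha.trans_le hk), Nat.testBit_lt_two_pow (hb.trans_le hk)]
  refine ⟨k, ofColumns k c, fun j h => hpos j ?_, fun j l h => hinj j l ?_,
    four_dvd_hammingNorm_vecMul h4 horth⟩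
  · exact ext_bits _ _ (hlt j) (by positivity) fun i => by simpa [ofColumns] using congrFun h i
  · exact ext_bits _ _ (hlt j) (hlt l) fun i => congrFun h i

theorem isLength_seven : IsLength 7 :=
  isLength_of_columns 3 ![1, 2, 3, 4, 5, 6, 7]
    (by decide) (by decide) (by decide) (by decide) (by decide)

theorem isLength_eight : IsLength 8 :=
  isLength_of_columns 4 ![8, 9, 10, 11, 12, 13, 14, 15]
    (by decide) (by decide) (by decide) (by decide) (by decide)

theorem isLength_seventeen : IsLength 17 :=
  isLength_of_columns 7
    ![72, 20, 55, 105, 43, 40, 39, 84, 113, 107, 23, 32, 119, 47, 97, 121, 31]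
    (by decide) (by decide) (by decide) (by decide) (by decide)

theorem isLength_eighteen : IsLength 18 :=
  isLength_of_columns 7
    ![104, 40, 49, 98, 102, 90, 85, 31, 22, 124, 103, 36, 101, 52, 73, 100, 127, 79]
    (by decide) (by decide) (by decide) (by decide) (by decide)

theorem isLength_nineteen : IsLength 19 :=
  isLength_of_columns 7
    ![121, 51, 56, 44, 65, 14, 89, 35, 86, 2, 53, 115, 61, 7, 112, 113, 57, 62, 69]
    (by decide) (by decide) (by decide) (by decide) (by decide)

theorem isLength_twenty : IsLength 20 :=
  isLength_of_columns 8
    ![20, 100, 22, 177, 16, 103, 254, 56, 50, 175, 25, 232, 34, 123, 163, 134, 214, 251, 67, 24]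
    (by decide) (by decide) (by decide) (by decide) (by decide)

theorem isLength_of_fourteen_le (n : ℕ) (hn : 14 ≤ n) : IsLength n := by
  induction n using Nat.strong_induction_on with
  | _ n ih =>
    by_cases h : 21 ≤ n
    · have := (ih (n - 7) (by omega) (by omega)).add isLength_seven
      rwa [Nat.sub_add_cancel (by omega)] at this
    · interval_cases n
      · exact isLength_seven.add isLength_seven
      · exact isLength_seven.add isLength_eight
      · exact isLength_eight.add isLength_eight
      · exact isLength_seventeen
      · exact isLength_eighteen
      · exact isLength_nineteen
      · exact isLength_twenty

end Constructions

section Moments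

/-- The nontrivial character of `ZMod 2`, with values in `ℤ`. -/
def sign (a : ZMod 2) : ℤ := if a = 0 then 1 else -1

theorem sign_add (a b : ZMod 2) : sign (a + b) = sign a * sign b := by
  revert a b; decide

variable {ι κ : Type*} [Fintype ι] [Fintype κ]

theorem sum_sign_eq_sub_hammingNorm (u : κ → ZMod 2) :
    ∑ j, sign (u j) = Fintype.card κ - 2 * hammingNorm u := by
  have key : ∀ a : ZMod 2, sign a = 1 - 2 * ((if a ≠ 0 then 1 else 0 : ℕ) : ℤ) := by decide
  simp only [hammingNorm, Finset.card_filter, key, Finset.sum_sub_distrib, ← Finset.mul_sum]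
  simp

variable [DecidableEq ι]

theorem sum_sign_dotProduct (v : ι → ZMod 2) :
    ∑ x : ι → ZMod 2, sign (x ⬝ᵥ v) = if v = 0 then 2 ^ Fintype.card ι else 0 := by
  split_ifs with h
  · simp [h, sign, ZMod.card]
  · obtain ⟨i, hi⟩ := Function.ne_iff.mp h
    have hi1 : v i = 1 := by
      have key : ∀ a : ZMod 2, a ≠ 0 → a = 1 := by decide
      exact key _ hi
    have hsum := Equiv.sum_comp (Equiv.addRight (Pi.single i 1 : ι → ZMod 2)) fun x =>
      sign (x ⬝ᵥ v)
    have hone : sign 1 = -1 := rfl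
    simp only [Equiv.coe_addRight, add_dotProduct, single_dotProduct, hi1, sign_add, mul_one,
      hone, mul_neg, Finset.sum_neg_distrib] at hsum
    linarith

theorem sum_sign_dotProduct_nonneg (v : ι → ZMod 2) :
    0 ≤ ∑ x : ι → ZMod 2, sign (x ⬝ᵥ v) := by
  rw [sum_sign_dotProduct]
  split_ifs <;> positivity

variable (G : Matrix ι κ (ZMod 2))

theorem sum_sum_sign_vecMul (h0 : ∀ j, (fun i => G i j) ≠ 0) :
    ∑ x : ι → ZMod 2, ∑ j, sign ((x ᵥ* G) j) = 0 := by
  rw [Finset.sum_comm]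
  exact Finset.sum_eq_zero fun j _ => (sum_sign_dotProduct _).trans (if_neg (h0 j))

theorem sum_sum_sign_vecMul_sq
    (h1 : ∀ j1 j2 : κ, (fun i => G i j1) = (fun i => G i j2) → j1 = j2) :
    ∑ x : ι → ZMod 2, (∑ j, sign ((x ᵥ* G) j)) ^ 2 =
      2 ^ Fintype.card ι * Fintype.card κ := by
  classical
  have key : ∀ j l : κ, ∑ x : ι → ZMod 2, sign ((x ᵥ* G) j) * sign ((x ᵥ* G) l) =
      if l = j then 2 ^ Fintype.card ι else 0 := by
    intro j l
    have h := sum_sign_dotProduct ((fun i => G i j) + fun i => G i l)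
    simp only [dotProduct_add, sign_add] at h
    refine h.trans (if_congr ?_ rfl rfl)
    have hadd : ∀ a b : ZMod 2, a + b = 0 ↔ b = a := by decide
    simp only [funext_iff, Pi.add_apply, Pi.zero_apply, hadd]
    exact ⟨fun h => h1 l j (funext h), fun h i => by rw [h]⟩
  simp_rw [sq, Finset.sum_mul_sum]
  rw [Finset.sum_comm]
  simp_rw [Finset.sum_comm (s := (Finset.univ : Finset (ι → ZMod 2))), key]
  simp [mul_comm]

theorem sum_sum_sign_vecMul_cube_nonneg :
    0 ≤ ∑ x : ι → ZMod 2, (∑ j, sign ((x ᵥ* G) j)) ^ 3 := by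
  simp_rw [pow_succ, pow_zero, one_mul, Finset.sum_mul_sum, Finset.sum_mul]
  rw [Finset.sum_comm]
  refine Finset.sum_nonneg fun a _ => ?_
  rw [Finset.sum_comm]
  refine Finset.sum_nonneg fun c _ => ?_
  rw [Finset.sum_comm]
  refine Finset.sum_nonneg fun b _ => ?_
  have h := sum_sign_dotProduct_nonneg ((fun i => G i a) + (fun i => G i b) + fun i => G i c)
  simp only [dotProduct_add, sign_add] at h
  exact h

end Moments

/-- The first three power moments of the weight distribution exclude all other lengths. -/
theorem IsLength.eq_or_le {n : ℕ} (hn : 0 < n) (h : IsLength n) : n = 7 ∨ n = 8 ∨ 14 ≤ n := by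
  obtain ⟨k, G, h0, h1, h4⟩ := h
  have hs1 := sum_sum_sign_vecMul G h0
  have hs2 := sum_sum_sign_vecMul_sq G h1
  have hs3 := sum_sum_sign_vecMul_cube_nonneg G
  have hval : ∀ x : Fin k → ZMod 2, ∃ m : ℕ, 4 * m ≤ n ∧
      ∑ j, sign ((x ᵥ* G) j) = (n : ℤ) - 8 * m := by
    intro x
    obtain ⟨m, hm⟩ := h4 x
    refine ⟨m, ?_, ?_⟩
    · simpa [← hm] using hammingNorm_le_card_fintype (x := x ᵥ* G)
    · rw [sum_sign_eq_sub_hammingNorm, hm]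
      push_cast [Fintype.card_fin]
      ring
  set s : (Fin k → ZMod 2) → ℤ := fun x => ∑ j, sign ((x ᵥ* G) j)
  change ∑ x, s x = 0 at hs1
  change ∑ x, s x ^ 2 = _ at hs2
  change 0 ≤ ∑ x, s x ^ 3 at hs3
  change ∀ x, ∃ m : ℕ, 4 * m ≤ n ∧ s x = (n : ℤ) - 8 * m at hval
  clear_value s
  rw [Fintype.card_fin, Fintype.card_fin] at hs2
  have hcard : ∑ _x : Fin k → ZMod 2, (1 : ℤ) = 2 ^ k := by simp [ZMod.card]
  have hN : (0 : ℤ) < 2 ^ k := by positivity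
  have hmoment : ∀ a b c d : ℤ, ∑ x, (a * s x ^ 3 + b * s x ^ 2 + c * s x + d * 1) =
      a * ∑ x, s x ^ 3 + (b * n + d) * 2 ^ k := by
    intro a b c d
    simp only [Finset.sum_add_distrib, ← Finset.mul_sum, hs1, hs2, hcard]
    ring
  by_contra! hne
  obtain ⟨hne7, hne8, hlt⟩ := hne
  rcases lt_or_ge n 8 with hn8 | hn8
  · have hzero : ∑ x, (0 * s x ^ 3 + 1 * s x ^ 2 + (8 - 2 * n) * s x + (n * (n - 8) : ℤ) * 1) =
        0 := by
      refine Finset.sum_eq_zero fun x _ => ?_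
      obtain ⟨m, hm, hx⟩ := hval x
      have hm1 : m < 2 := by omega
      rw [hx]
      interval_cases m <;> push_cast <;> ring
    rw [hmoment] at hzero
    have h7 : (n : ℤ) * (n - 7) * 2 ^ k = 0 := by linear_combination hzero
    simp only [mul_eq_zero, hN.ne', or_false] at h7
    omega
  · obtain rfl | hn10 : n = 9 ∨ 10 ≤ n := by omega
    · have hzero : ∑ x, (1 * s x ^ 3 + (-3) * s x ^ 2 + (-61) * s x + 63 * 1) = 0 := by
        refine Finset.sum_eq_zero fun x _ => ?_
        obtain ⟨m, hm, hx⟩ := hval x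
        have hm1 : m < 3 := by omega
        rw [hx]
        interval_cases m <;> norm_num
      rw [hmoment] at hzero
      push_cast at hzero
      linarith
    · have hnonneg : 0 ≤ ∑ x, (0 * s x ^ 3 + 1 * s x ^ 2 + (24 - 2 * n) * s x +
          ((n - 8) * (n - 16) : ℤ) * 1) := by
        refine Finset.sum_nonneg fun x _ => ?_
        obtain ⟨m, hm, hx⟩ := hval x
        have hm1 : m < 4 := by omega
        rw [hx]
        interval_cases m <;> push_cast <;> ring_nf <;> norm_num
      rw [hmoment] at hnonneg
      interval_cases n <;> push_cast at hnonneg <;> linarith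

end BinaryCode

/-- The set of lengths of projective doubly-even binary linear codes is exactly
{7, 8} ∪ {n : n ≥ 14}. -/
theorem lengths_projective_doubly_even (n : ℕ) (hn : 0 < n) :
    (∃ (k : ℕ) (G : Matrix (Fin k) (Fin n) (ZMod 2)),
        (∀ j, (fun i => G i j) ≠ 0) ∧
        (∀ j1 j2 : Fin n, (fun i => G i j1) = (fun i => G i j2) → j1 = j2) ∧
        (∀ x : Fin k → ZMod 2, 4 ∣ hammingNorm (x ᵥ* G))) ↔
      (n = 7 ∨ n = 8 ∨ 14 ≤ n) := by
  refine ⟨fun h => BinaryCode.IsLength.eq_or_le hn h, ?_⟩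
  rintro (rfl | rfl | h)
  · exact BinaryCode.isLength_seven
  · exact BinaryCode.isLength_eight
  · exact BinaryCode.isLength_of_fourteen_le n h
end
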